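/- If T is a theory that is stably finite and finitely smooth with respect to a set of sorts S (over a countable many-sorted signature), then T is smooth with respect to S: for any quantifier-free formula φ, T-interpretation 𝒜 satisfying φ, and function κ from S to cardinals with κ(σ) ≥ |σ^𝒜| for all σ ∈ S, there is a T-interpretation ℬ satisfying φ with |σ^ℬ| = κ(σ) for every σ ∈ S. -/

import Mathlib

set_option autoImplicit false

/-- A many-sorted first-order signature. -/
structure MSSignature : Type 1 where
  Sorts : Type
  Func : Type
  Pred : Type
  funcDom : Func → List Sorts
  funcCod : Func → Sorts
  predDom : Pred → List Sorts

namespace MS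

variable (Sg : MSSignature)

/-- Many-sorted terms; variables of each sort are indexed by naturals. -/
inductive Term : Sg.Sorts → Type where
  | var (s : Sg.Sorts) (n : ℕ) : Term s
  | app (f : Sg.Func)
      (args : ∀ i : Fin (Sg.funcDom f).length, Term ((Sg.funcDom f).get i)) :
      Term (Sg.funcCod f)

/-- Many-sorted first-order formulas. -/
inductive Formula : Type where
  | eq {s : Sg.Sorts} (t u : Term Sg s) : Formula
  | pred (P : Sg.Pred)
      (args : ∀ i : Fin (Sg.predDom P).length, Term Sg ((Sg.predDom P).get i)) : Formula
  | falsum : Formula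
  | imp (φ ψ : Formula) : Formula
  | all (s : Sg.Sorts) (n : ℕ) (φ : Formula) : Formula

/-- A structure for a many-sorted signature: each sort gets a nonempty domain. -/
structure Structure : Type 1 where
  dom : Sg.Sorts → Type
  dom_nonempty : ∀ s, Nonempty (dom s)
  interpFunc : ∀ f : Sg.Func,
    (∀ i : Fin (Sg.funcDom f).length, dom ((Sg.funcDom f).get i)) → dom (Sg.funcCod f)
  interpPred : ∀ P : Sg.Pred,
    (∀ i : Fin (Sg.predDom P).length, dom ((Sg.predDom P).get i)) → Prop

variable {Sg}

/-- Variable assignments. -/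
def Assign (A : Structure Sg) : Type := ∀ s : Sg.Sorts, ℕ → A.dom s

open Classical in
noncomputable
def Assign.update {A : Structure Sg} (ν : Assign A) (s : Sg.Sorts) (n : ℕ) (a : A.dom s) :
    Assign A := fun t m =>
  if h : s = t then (if m = n then h ▸ a else ν t m) else ν t m

def Term.eval {A : Structure Sg} (ν : Assign A) : ∀ {s : Sg.Sorts}, Term Sg s → A.dom s
  | _, .var s n => ν s n
  | _, .app f args => A.interpFunc f fun i => Term.eval ν (args i)

/-- Tarskian satisfaction. -/
def Sat (A : Structure Sg) (ν : Assign A) : Formula Sg → Prop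
  | .eq t u => t.eval ν = u.eval ν
  | .pred P args => A.interpPred P fun i => (args i).eval ν
  | .falsum => False
  | .imp φ ψ => Sat A ν φ → Sat A ν ψ
  | .all s n φ => ∀ a : A.dom s, Sat A (ν.update s n a) φ

/-- Derived connectives. -/
def Formula.not (φ : Formula Sg) : Formula Sg := .imp φ .falsum
def Formula.and (φ ψ : Formula Sg) : Formula Sg := (Formula.imp φ ψ.not).not
def Formula.or (φ ψ : Formula Sg) : Formula Sg := .imp φ.not ψ
def Formula.ex (s : Sg.Sorts) (n : ℕ) (φ : Formula Sg) : Formula Sg :=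
  ((Formula.all s n φ.not)).not
def Formula.andList : List (Formula Sg) → Formula Sg :=
  List.foldr Formula.and (Formula.not .falsum)
def Formula.orList : List (Formula Sg) → Formula Sg :=
  List.foldr Formula.or .falsum

/-- Occurrence of variable `(s, n)` in a term. -/
def Term.varOccurs (s : Sg.Sorts) (n : ℕ) : ∀ {t : Sg.Sorts}, Term Sg t → Prop
  | _, .var s' n' => s = s' ∧ n = n'
  | _, .app _ args => ∃ i, Term.varOccurs s n (args i)

/-- Free occurrence of variable `(s, n)` in a formula. -/
def Formula.varFree (s : Sg.Sorts) (n : ℕ) : Formula Sg → Prop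
  | .eq t u => t.varOccurs s n ∨ u.varOccurs s n
  | .pred _ args => ∃ i, (args i).varOccurs s n
  | .falsum => False
  | .imp φ ψ => φ.varFree s n ∨ ψ.varFree s n
  | .all s' n' φ => φ.varFree s n ∧ ¬(s = s' ∧ n = n')

def Formula.IsSentence (φ : Formula Sg) : Prop := ∀ s n, ¬ φ.varFree s n

/-- Quantifier-free formulas. -/
def Formula.IsQF : Formula Sg → Prop
  | .eq _ _ => True
  | .pred _ _ => True
  | .falsum => True
  | .imp φ ψ => φ.IsQF ∧ ψ.IsQF
  | .all _ _ _ => False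

/-- A structure is a model of a set of formulas (a theory) if it satisfies
every axiom under every assignment. -/
def Models (A : Structure Sg) (T : Set (Formula Sg)) : Prop :=
  ∀ φ ∈ T, ∀ ν : Assign A, Sat A ν φ

/-- Elementary equivalence: same sentences hold. -/
def ElemEquiv (A B : Structure Sg) : Prop :=
  ∀ φ : Formula Sg, φ.IsSentence →
    ((∀ ν : Assign A, Sat A ν φ) ↔ (∀ ν : Assign B, Sat B ν φ))

/-- Substructures: sort-wise subsets closed under the functions. -/
structure Substructure (A : Structure Sg) : Type 1 where
  carrier : ∀ s : Sg.Sorts, Set (A.dom s)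
  carrier_nonempty : ∀ s, (carrier s).Nonempty
  closed : ∀ (f : Sg.Func)
    (args : ∀ i : Fin (Sg.funcDom f).length, A.dom ((Sg.funcDom f).get i)),
    (∀ i, args i ∈ carrier _) → A.interpFunc f args ∈ carrier _

/-- The induced structure on a substructure. -/
def Substructure.toStructure {A : Structure Sg} (B : Substructure A) : Structure Sg where
  dom s := ↥(B.carrier s)
  dom_nonempty s := ⟨⟨(B.carrier_nonempty s).choose, (B.carrier_nonempty s).choose_spec⟩⟩
  interpFunc f args :=
    ⟨A.interpFunc f fun i => (args i).1, B.closed f _ fun i => (args i).2⟩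
  interpPred P args := A.interpPred P fun i => (args i).1

/-- View an assignment into a substructure as an assignment into the ambient structure. -/
def Substructure.amb {A : Structure Sg} (B : Substructure A)
    (ν : Assign B.toStructure) : Assign A := fun s n => (ν s n).1

/-- `B` is an elementary substructure of `A`. -/
def Substructure.IsElementary {A : Structure Sg} (B : Substructure A) : Prop :=
  ∀ (φ : Formula Sg) (ν : Assign B.toStructure),
    Sat B.toStructure ν φ ↔ Sat A (B.amb ν) φ

/-- Isomorphisms of structures. -/
structure Iso (A B : Structure Sg) : Type 1 where
  toEquiv : ∀ s, A.dom s ≃ B.dom s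
  map_func : ∀ (f : Sg.Func) args,
    toEquiv _ (A.interpFunc f args) = B.interpFunc f (fun i => toEquiv _ (args i))
  map_pred : ∀ (P : Sg.Pred) args,
    A.interpPred P args ↔ B.interpPred P (fun i => toEquiv _ (args i))

end MS

/-- The cardinality of a signature: sorts + function symbols + predicate symbols. -/
noncomputable def MSSignature.card (Sg : MSSignature) : Cardinal :=
  Cardinal.mk Sg.Sorts + Cardinal.mk Sg.Func + Cardinal.mk Sg.Pred

/-- A countable signature. -/
def MSSignature.IsCountable (Sg : MSSignature) : Prop :=
  Countable Sg.Sorts ∧ Countable Sg.Func ∧ Countable Sg.Pred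

open MS Cardinal

namespace MS

variable {Sg : MSSignature}

/-- `T` is stably finite with respect to a set of sorts `S`: every quantifier-free
formula satisfied in a model of `T` is satisfied in a model of `T` whose domains at
the sorts in `S` are finite and no larger than the original ones. -/
def StablyFinite (T : Set (Formula Sg)) (S : Set Sg.Sorts) : Prop :=
  ∀ φ : Formula Sg, φ.IsQF →
    ∀ (A : Structure Sg) (ν : Assign A), Models A T → Sat A ν φ →
      ∃ (B : Structure Sg) (μ : Assign B), Models B T ∧ Sat B μ φ ∧
        ∀ s ∈ S, #(B.dom s) ≤ #(A.dom s) ∧ Finite (B.dom s)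

/-- `T` is finitely smooth with respect to `S`: the domains at sorts of `S` that are
finite can be enlarged to any prescribed larger finite cardinalities while preserving
satisfaction of a given quantifier-free formula. -/
def FinitelySmooth (T : Set (Formula Sg)) (S : Set Sg.Sorts) : Prop :=
  ∀ φ : Formula Sg, φ.IsQF →
    ∀ (A : Structure Sg) (ν : Assign A), Models A T → Sat A ν φ →
      ∀ κ : Sg.Sorts → Cardinal,
        (∀ s ∈ S, Finite (A.dom s) → #(A.dom s) ≤ κ s ∧ κ s < ℵ₀) →
        ∃ (B : Structure Sg) (μ : Assign B), Models B T ∧ Sat B μ φ ∧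
          ∀ s ∈ S, Finite (A.dom s) → #(B.dom s) = κ s

/-- `T` is smooth with respect to `S`: the domains at sorts of `S` can be enlarged to
any prescribed cardinalities while preserving satisfaction of a given quantifier-free
formula. -/
def Smooth (T : Set (Formula Sg)) (S : Set Sg.Sorts) : Prop :=
  ∀ φ : Formula Sg, φ.IsQF →
    ∀ (A : Structure Sg) (ν : Assign A), Models A T → Sat A ν φ →
      ∀ κ : Sg.Sorts → Cardinal, (∀ s ∈ S, #(A.dom s) ≤ κ s) →
        ∃ (B : Structure Sg) (μ : Assign B), Models B T ∧ Sat B μ φ ∧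
          ∀ s ∈ S, #(B.dom s) = κ s

end MS

/-! ### Iterated ultrafilters -/

namespace MSP

open Filter

open Classical in
/-- Iterated ultrafilter quantifier along a list of coordinates. -/
noncomputable def Qf {V : Type} : List V → (V → ℕ) → Ultrafilter (V → ℕ)
  | [], v => pure v
  | x :: l, v => Ultrafilter.bind (hyperfilter ℕ) (fun a => Qf l (Function.update v x a))

section comb
variable {V : Type}

theorem Qf_nil (v : V → ℕ) (P : (V → ℕ) → Prop) :
    (∀ᶠ w in (Qf [] v : Filter (V → ℕ)), P w) ↔ P v := Iff.rfl

open Classical in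
theorem Qf_cons (x : V) (l : List V) (v : V → ℕ) (P : (V → ℕ) → Prop) :
    (∀ᶠ w in (Qf (x :: l) v : Filter (V → ℕ)), P w) ↔
      ∀ᶠ a in (hyperfilter ℕ : Filter ℕ),
        ∀ᶠ w in (Qf l (Function.update v x a) : Filter (V → ℕ)), P w := Iff.rfl

theorem Qf_append (l₁ l₂ : List V) (v : V → ℕ) (P : (V → ℕ) → Prop) :
    (∀ᶠ w in (Qf (l₁ ++ l₂) v : Filter (V → ℕ)), P w) ↔
      ∀ᶠ w in (Qf l₁ v : Filter (V → ℕ)), ∀ᶠ u in (Qf l₂ w : Filter (V → ℕ)), P u := by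
  induction l₁ generalizing v with
  | nil => exact Iff.rfl
  | cons x l ih =>
    rw [List.cons_append, Qf_cons, Qf_cons]
    simp only [ih]

open Classical in
theorem Qf_outside (l : List V) (v : V → ℕ) :
    ∀ᶠ w in (Qf l v : Filter (V → ℕ)), ∀ x ∉ l, w x = v x := by
  induction l generalizing v with
  | nil => rw [Qf_nil]; simp
  | cons x l ih =>
    rw [Qf_cons]
    refine Eventually.of_forall fun a => (ih _).mono fun w hw y hy => ?_
    rw [hw y (fun h => hy (List.mem_cons_of_mem _ h))]
    rw [Function.update_of_ne]
    rintro rfl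
    exact hy List.mem_cons_self

open Classical in
theorem Qf_filter (D : Set V) (P : (V → ℕ) → Prop)
    (hP : ∀ w w', Set.EqOn w w' D → (P w ↔ P w')) (l : List V) (v v' : V → ℕ)
    (hv : Set.EqOn v v' D) :
    (∀ᶠ w in (Qf l v : Filter (V → ℕ)), P w) ↔
      ∀ᶠ w in (Qf (l.filter (fun x => decide (x ∈ D))) v' : Filter (V → ℕ)), P w := by
  induction l generalizing v v' with
  | nil => rw [List.filter_nil, Qf_nil, Qf_nil]; exact hP _ _ hv
  | cons x l ih =>
    by_cases hx : x ∈ D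
    · rw [List.filter_cons_of_pos (by simpa using hx), Qf_cons, Qf_cons]
      refine eventually_congr (Eventually.of_forall fun a => ih _ _ ?_)
      intro y hy
      by_cases h : y = x
      · subst h; simp
      · simp [Function.update_of_ne h, hv hy]
    · rw [List.filter_cons_of_neg (by simpa using hx), Qf_cons]
      have : ∀ a, (∀ᶠ w in (Qf l (Function.update v x a) : Filter (V → ℕ)), P w) ↔
          ∀ᶠ w in (Qf (l.filter (fun x => decide (x ∈ D))) v' : Filter (V → ℕ)), P w := by
        intro a
        refine ih _ _ ?_
        intro y hy
        have h : y ≠ x := by rintro rfl; exact hx hy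
        simp [Function.update_of_ne h, hv hy]
      simp only [this]
      simp

open Classical in
theorem Qf_map (D : Set V) (γ : V → V) (hγ : Set.InjOn γ D) (P : (V → ℕ) → Prop)
    (hP : ∀ w w', Set.EqOn w w' D → (P w ↔ P w')) (l : List V) (hl : ∀ x ∈ l, x ∈ D)
    (v v' : V → ℕ) (hv : Set.EqOn (v ∘ γ) v' D) :
    (∀ᶠ w in (Qf (l.map γ) v : Filter (V → ℕ)), P (w ∘ γ)) ↔
      ∀ᶠ w in (Qf l v' : Filter (V → ℕ)), P w := by
  induction l generalizing v v' with
  | nil => rw [List.map_nil, Qf_nil, Qf_nil]; exact hP _ _ hv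
  | cons x l ih =>
    rw [List.map_cons, Qf_cons, Qf_cons]
    refine eventually_congr (Eventually.of_forall fun a =>
      ih (fun y hy => hl y (List.mem_cons_of_mem _ hy)) _ _ ?_)
    intro y hy
    by_cases h : y = x
    · subst h; simp
    · have h' : γ y ≠ γ x := fun e => h (hγ hy (hl x List.mem_cons_self) e)
      have := hv hy
      simp only [Function.comp] at this ⊢
      rw [Function.update_of_ne h, Function.update_of_ne h', this]

theorem exists_const (F : Ultrafilter (V → ℕ)) (f : (V → ℕ) → ℕ) (b : ℕ)
    (h : ∀ᶠ v in (F : Filter (V → ℕ)), f v ≤ b) : ∃ a, ∀ᶠ v in (F : Filter (V → ℕ)), f v = a := by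
  have := (Ultrafilter.eventually_exists_mem_iff (f := F) (P := fun a v => f v = a)
    (Set.finite_Iic b)).1 (h.mono fun v hv => ⟨f v, hv, rfl⟩)
  obtain ⟨a, -, ha⟩ := this
  exact ⟨a, ha⟩

theorem comb (V : Type) [LinearOrder V] : ∃ F : Ultrafilter (V → ℕ),
    (∀ x y : V, x < y → ∀ᶠ v in (F : Filter (V → ℕ)), v x < v y) ∧
    (∀ (p : V) (D : Set V) (γ : V → V) (f : (V → ℕ) → ℕ) (B : ℕ → ℕ),
      p ∈ D → StrictMonoOn γ D → (∀ x ∈ D, x ≤ p → γ x = x) → {x ∈ D | γ x ≠ x}.Finite →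
      (∀ v v', Set.EqOn v v' D → f v = f v') → (∀ v, f v ≤ B (v p)) →
      ∀ᶠ v in (F : Filter (V → ℕ)), f v = f (v ∘ γ)) := by
  classical
  let F : Ultrafilter (V → ℕ) := Ultrafilter.bind (Ultrafilter.of (atTop : Filter (Finset V)))
    (fun W => Qf W.sort (fun _ => 0))
  have hF : ∀ (P : (V → ℕ) → Prop) (W₀ : Finset V), (∀ W : Finset V, W₀ ⊆ W →
      ∀ᶠ w in (Qf W.sort (fun _ => 0) : Filter (V → ℕ)), P w) →
      ∀ᶠ w in (F : Filter (V → ℕ)), P w := by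
    intro P W₀ h
    have : ∀ᶠ W in (Ultrafilter.of (atTop : Filter (Finset V)) : Filter (Finset V)),
      ∀ᶠ w in (Qf W.sort (fun _ => 0) : Filter (V → ℕ)), P w :=
      (Ultrafilter.of_le _) ((eventually_ge_atTop W₀).mono fun W hW => h W hW)
    exact this
  refine ⟨F, ?_, ?_⟩
  · intro x y hxy
    refine hF _ {x, y} fun W hW => ?_
    obtain ⟨D₀, hD₀⟩ : ∃ D₀ : Set V, D₀ = {x, y} := ⟨_, rfl⟩
    have hx0 : x ∈ D₀ := by simp [hD₀]
    have hy0 : y ∈ D₀ := by simp [hD₀]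
    rw [Qf_filter D₀ _ ?_ _ _ _ (fun _ _ => rfl)]
    · have : W.sort.filter (fun z => decide (z ∈ D₀)) = [x, y] := by
        refine List.SortedLT.eq_of_mem_iff ?_ ?_ ?_
        · exact (W.sortedLT_sort.pairwise.filter _).sortedLT
        · exact List.Pairwise.sortedLT (by simpa using hxy)
        · intro a
          have := @hW a
          simp [hD₀] at this ⊢
          grind
      rw [this, Qf_cons]
      refine Eventually.of_forall fun a => ?_
      rw [Qf_cons]
      have : ∀ᶠ b in (hyperfilter ℕ : Filter ℕ), a < b := by
        exact Nat.hyperfilter_le_atTop (eventually_gt_atTop a)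
      refine this.mono fun b hb => ?_
      rw [Qf_nil]
      simp [Function.update, hxy.ne, hb]
    · intro w w' h
      rw [h hx0, h hy0]
  · intro p D γ f B hp hmono hid hfin hf hB
    refine hF _ ({p} ∪ hfin.toFinset ∪ hfin.toFinset.image γ) fun W hW => ?_
    have hpW : p ∈ W := hW (by simp)
    have hW1 : ∀ x ∈ D, γ x ≠ x → x ∈ W ∧ γ x ∈ W := by
      intro x hx hne
      have h0 : x ∈ hfin.toFinset := by simp [hx, hne]
      exact ⟨hW (by simp [hx, hne]), hW (Finset.mem_union_right _ (Finset.mem_image_of_mem _ h0))⟩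
    have hW2 : ∀ x ∈ D, (γ x ∈ W ↔ x ∈ W) := by
      intro x hx
      by_cases h : γ x = x
      · rw [h]
      · have := hW1 x hx h
        tauto
    have hsp := W.sortedLT_sort.pairwise
    set l₁ := W.sort.filter (fun x => decide (x ≤ p)) with hl₁
    set l₂ := W.sort.filter (fun x => decide (p < x)) with hl₂
    have m₁ : ∀ x, x ∈ l₁ ↔ x ∈ W ∧ x ≤ p := by simp [hl₁]
    have m₂ : ∀ x, x ∈ l₂ ↔ x ∈ W ∧ p < x := by simp [hl₂]
    have hl : W.sort = l₁ ++ l₂ := by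
      refine List.SortedLT.eq_of_mem_iff W.sortedLT_sort ?_ ?_
      · refine List.Pairwise.sortedLT (List.pairwise_append.2 ⟨hsp.filter _, hsp.filter _, ?_⟩)
        intro a ha b hb
        exact ((m₁ a).1 ha).2.trans_lt ((m₂ b).1 hb).2
      · intro a
        rw [List.mem_append, m₁, m₂, Finset.mem_sort]
        have := le_or_gt a p
        tauto
    rw [hl, Qf_append]
    refine (Qf_outside l₁ (fun _ => 0)).mono fun w hw => ?_
    have hup : ∀ᶠ u in (Qf l₂ w : Filter (V → ℕ)), u p = w p :=
      (Qf_outside l₂ w).mono fun u hu => hu p (fun h => lt_irrefl _ ((m₂ p).1 h).2)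
    obtain ⟨a, ha⟩ := exists_const (Qf l₂ w) f (B (w p)) (hup.mono fun u hu => hu ▸ hB u)
    obtain ⟨a', ha'⟩ := exists_const (Qf l₂ w) (fun u => f (u ∘ γ)) (B (w p))
      (hup.mono fun u hu => by
        have := hB (u ∘ γ)
        simpa [hid p hp le_rfl, hu] using this)
    have hwγ : Set.EqOn (w ∘ γ) w D := by
      intro x hx
      rcases le_or_gt x p with h | h
      · simp [hid x hx h]
      · have h' : p < γ x := by
          have := hmono hp hx h
          rwa [hid p hp le_rfl] at this
        have e1 := hw x (fun h0 => absurd ((m₁ x).1 h0).2 (not_le.2 h))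
        have e2 := hw (γ x) (fun h0 => absurd ((m₁ _).1 h0).2 (not_le.2 h'))
        simp [e1, e2]
    have e1 : ∀ᶠ u in (Qf (l₂.filter (fun x => decide (x ∈ D))) w : Filter (V → ℕ)), f u = a := by
      rwa [← Qf_filter D (fun u => f u = a) ?_ _ w w (fun _ _ => rfl)]
      intro u u' h
      simp only [hf u u' h]
    have e2 : ∀ᶠ u in (Qf (l₂.filter (fun x => decide (x ∈ D))) w : Filter (V → ℕ)), f u = a' := by
      rw [← Qf_map D γ hmono.injOn (fun u => f u = a') ?_ _ ?_ w w hwγ]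
      · rw [Qf_filter (γ '' D) (fun u => f (u ∘ γ) = a') ?_ _ w w (fun _ _ => rfl)] at ha'
        · convert ha' using 3
          refine List.SortedLT.eq_of_mem_iff ?_ ?_ ?_
          · refine List.Pairwise.sortedLT ?_
            rw [List.pairwise_map]
            refine List.Pairwise.imp_of_mem ?_ ((hsp.filter _).filter _)
            intro x y hx hy hxy
            simp only [List.mem_filter, decide_eq_true_eq] at hx hy
            exact hmono hx.2 hy.2 hxy
          · exact ((hsp.filter _).filter _).sortedLT
          · intro y
            simp only [List.mem_map, List.mem_filter, decide_eq_true_eq, m₂, Set.mem_image]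
            constructor
            · rintro ⟨x, ⟨⟨hx1, hx2⟩, hx3⟩, rfl⟩
              refine ⟨⟨(hW2 x hx3).2 hx1, ?_⟩, x, hx3, rfl⟩
              have := hmono hp hx3 hx2
              rwa [hid p hp le_rfl] at this
            · rintro ⟨⟨h1, h2⟩, x, hx, rfl⟩
              refine ⟨x, ⟨⟨(hW2 x hx).1 h1, ?_⟩, hx⟩, rfl⟩
              by_contra h
              rw [hid x hx (not_lt.1 h)] at h2
              exact h h2
        · intro u u' h
          have : f (u ∘ γ) = f (u' ∘ γ) := hf _ _ fun x hx => h (Set.mem_image_of_mem _ hx)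
          simp only [this]
      · intro u u' h
        simp only [hf u u' h]
      · intro x hx
        simp only [List.mem_filter, decide_eq_true_eq] at hx
        exact hx.2
    have haa : a = a' := by
      obtain ⟨u, h1, h2⟩ := (e1.and e2).exists
      exact h1.symm.trans h2
    filter_upwards [ha, ha'] with u h1 h2
    rw [h1, h2, haa]

end comb
end MSP
/-! ### Skolem terms and Skolem hulls -/

namespace MSP

open Filter

section sk
variable {Sg : MSSignature}

theorem term_supp {s : Sg.Sorts} (t : Term Sg s) : ∃ L : Finset (Sg.Sorts × ℕ),
    ∀ (A : Structure Sg) (ν ν' : Assign A), (∀ p ∈ L, ν p.1 p.2 = ν' p.1 p.2) →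
      t.eval ν = t.eval ν' := by
  classical
  induction t with
  | var s n => exact ⟨{(s, n)}, fun A ν ν' h => h (s, n) (by simp)⟩
  | app f args ih =>
    choose L hL using ih
    refine ⟨Finset.univ.biUnion L, fun A ν ν' h => ?_⟩
    simp only [Term.eval]
    congr 1
    funext i
    exact hL i A ν ν' fun p hp => h p (Finset.mem_biUnion.2 ⟨i, Finset.mem_univ _, hp⟩)

theorem sat_supp (φ : Formula Sg) : ∃ L : Finset (Sg.Sorts × ℕ),
    ∀ (A : Structure Sg) (ν ν' : Assign A), (∀ p ∈ L, ν p.1 p.2 = ν' p.1 p.2) →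
      (Sat A ν φ ↔ Sat A ν' φ) := by
  classical
  induction φ with
  | eq t u =>
    obtain ⟨L, hL⟩ := term_supp t
    obtain ⟨L', hL'⟩ := term_supp u
    refine ⟨L ∪ L', fun A ν ν' h => ?_⟩
    simp only [Sat]
    rw [hL A ν ν' fun p hp => h p (Finset.mem_union_left _ hp),
      hL' A ν ν' fun p hp => h p (Finset.mem_union_right _ hp)]
  | pred P args =>
    choose L hL using fun i => term_supp (args i)
    refine ⟨Finset.univ.biUnion L, fun A ν ν' h => ?_⟩
    simp only [Sat]
    have : (fun i => (args i).eval ν) = (fun i => (args i).eval ν') := by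
      funext i
      exact hL i A ν ν' fun p hp => h p (Finset.mem_biUnion.2 ⟨i, Finset.mem_univ _, hp⟩)
    rw [this]
  | falsum => exact ⟨∅, fun A ν ν' h => Iff.rfl⟩
  | imp φ ψ ih ih' =>
    obtain ⟨L, hL⟩ := ih
    obtain ⟨L', hL'⟩ := ih'
    refine ⟨L ∪ L', fun A ν ν' h => ?_⟩
    simp only [Sat]
    rw [hL A ν ν' fun p hp => h p (Finset.mem_union_left _ hp),
      hL' A ν ν' fun p hp => h p (Finset.mem_union_right _ hp)]
  | all s n φ ih =>
    obtain ⟨L, hL⟩ := ih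
    refine ⟨L, fun A ν ν' h => ?_⟩
    simp only [Sat]
    refine forall_congr' fun a => hL A _ _ fun p hp => ?_
    simp only [Assign.update]
    rw [h p hp]

/-- A finite set of variables on which satisfaction of a formula depends. -/
noncomputable def Lv (φ : Formula Sg) : Finset (Sg.Sorts × ℕ) := (sat_supp φ).choose

theorem Lv_spec (φ : Formula Sg) (A : Structure Sg) (ν ν' : Assign A)
    (h : ∀ s n, (s, n) ∈ Lv φ → ν s n = ν' s n) : Sat A ν φ ↔ Sat A ν' φ :=
  (sat_supp φ).choose_spec A ν ν' fun p hp => h p.1 p.2 hp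

open Classical in
/-- Skolem functions. -/
noncomputable def wit (A : Structure Sg) (ψ : Formula Sg) (s : Sg.Sorts) (n : ℕ) (ν : Assign A) :
    A.dom s :=
  if h : ∃ a, ¬ Sat A (ν.update s n a) ψ then h.choose else (A.dom_nonempty s).some

theorem wit_spec (A : Structure Sg) (ψ : Formula Sg) (s : Sg.Sorts) (n : ℕ) (ν : Assign A)
    (h : ∃ a, ¬ Sat A (ν.update s n a) ψ) : ¬ Sat A (ν.update s n (wit A ψ s n ν)) ψ := by
  unfold wit
  rw [dif_pos h]
  exact h.choose_spec

/-- Skolem terms over generators `X`. -/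
inductive STm (X : Sg.Sorts → Type) : Sg.Sorts → Type where
  | gen (s : Sg.Sorts) (x : X s) : STm X s
  | cst (s : Sg.Sorts) (k : ℕ ⊕ ℕ) : STm X s
  | app (f : Sg.Func)
      (args : ∀ i : Fin (Sg.funcDom f).length, STm X ((Sg.funcDom f).get i)) :
      STm X (Sg.funcCod f)
  | sk (ψ : Formula Sg) (s : Sg.Sorts) (n : ℕ) (args : ∀ p : {p // p ∈ Lv ψ}, STm X p.1.1) : STm X s

variable {X Y Z : Sg.Sorts → Type}

open Classical in
/-- Extend a partial assignment to a total one. -/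
noncomputable def ext (A : Structure Sg) (L : Finset (Sg.Sorts × ℕ))
    (a : ∀ p : {p // p ∈ L}, A.dom p.1.1) : Assign A :=
  fun s n => if h : (s, n) ∈ L then a ⟨(s, n), h⟩ else (A.dom_nonempty s).some

noncomputable def STm.eval (A : Structure Sg) (pt : ∀ s, ℕ ⊕ ℕ → A.dom s) (c : ∀ s, X s → ℕ) :
    ∀ {s : Sg.Sorts}, STm X s → A.dom s
  | _, .gen s x => pt s (Sum.inr (c s x))
  | _, .cst s k => pt s k
  | _, .app f args => A.interpFunc f fun i => (args i).eval A pt c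
  | _, .sk ψ s n args => wit A ψ s n (ext A (Lv ψ) fun p => (args p).eval A pt c)

def STm.map (g : ∀ s, X s → Y s) : ∀ {s : Sg.Sorts}, STm X s → STm Y s
  | _, .gen s x => .gen s (g s x)
  | _, .cst s k => .cst s k
  | _, .app f args => .app f fun i => (args i).map g
  | _, .sk ψ s n args => .sk ψ s n fun p => (args p).map g

def STm.used : ∀ {s : Sg.Sorts}, STm X s → Set (Σ s, X s)
  | _, .gen s x => {⟨s, x⟩}
  | _, .cst _ _ => ∅
  | _, .app _ args => ⋃ i, (args i).used
  | _, .sk _ _ _ args => ⋃ p, (args p).used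

theorem STm.used_finite {s : Sg.Sorts} (t : STm X s) : t.used.Finite := by
  induction t with
  | gen s x => simp [STm.used]
  | cst s k => simp [STm.used]
  | app f args ih => exact Set.finite_iUnion ih
  | sk ψ s n args ih => exact Set.finite_iUnion ih

theorem STm.eval_map (A : Structure Sg) (pt : ∀ s, ℕ ⊕ ℕ → A.dom s) (c : ∀ s, Y s → ℕ)
    (g : ∀ s, X s → Y s) {s : Sg.Sorts} (t : STm X s) :
    (t.map g).eval A pt c = t.eval A pt (fun s x => c s (g s x)) := by
  induction t with
  | gen s x => rfl
  | cst s k => rfl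
  | app f args ih => simp only [STm.map, STm.eval, ih]
  | sk ψ s n args ih => simp only [STm.map, STm.eval, ih]

theorem STm.map_map (g : ∀ s, X s → Y s) (h : ∀ s, Y s → Z s) {s : Sg.Sorts} (t : STm X s) :
    (t.map g).map h = t.map (fun s x => h s (g s x)) := by
  induction t with
  | gen s x => rfl
  | cst s k => rfl
  | app f args ih => simp only [STm.map, ih]
  | sk ψ s n args ih => simp only [STm.map, ih]

theorem STm.eval_congr (A : Structure Sg) (pt : ∀ s, ℕ ⊕ ℕ → A.dom s) (c c' : ∀ s, X s → ℕ)
    {s : Sg.Sorts} (t : STm X s) (h : ∀ s x, (⟨s, x⟩ : Σ s, X s) ∈ t.used → c s x = c' s x) :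
    t.eval A pt c = t.eval A pt c' := by
  induction t with
  | gen s x => simp only [STm.eval]; rw [h s x (by simp [STm.used])]
  | cst s k => rfl
  | app f args ih =>
    simp only [STm.eval]
    congr 1
    funext i
    exact ih i fun s x hx => h s x (Set.mem_iUnion.2 ⟨i, hx⟩)
  | sk ψ s n args ih =>
    simp only [STm.eval]
    congr 2
    funext i
    exact ih i fun s x hx => h s x (Set.mem_iUnion.2 ⟨i, hx⟩)

/-! Cardinality of the sets of terms, formulas, Skolem terms -/

theorem wmk {α : Type} {β : α → Type} {a a' : α} {f : β a → WType β} {f' : β a' → WType β}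
    (h : WType.mk a f = WType.mk a' f') : a = a' ∧ f ≍ f' := by
  cases h
  exact ⟨rfl, HEq.rfl⟩

def tW : ∀ {s : Sg.Sorts}, Term Sg s →
    WType (α := (Sg.Sorts × ℕ) ⊕ Sg.Func)
      (Sum.elim (fun _ => Empty) (fun f => Fin (Sg.funcDom f).length))
  | _, .var s n => ⟨Sum.inl (s, n), Empty.elim⟩
  | _, .app f args => ⟨Sum.inr f, fun i => tW (args i)⟩

theorem tW_inj {s : Sg.Sorts} (t : Term Sg s) : ∀ {s' : Sg.Sorts} (t' : Term Sg s'),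
    tW t = tW t' → (⟨s, t⟩ : Σ s, Term Sg s) = ⟨s', t'⟩ := by
  induction t with
  | var s n =>
    intro s' t' h
    cases t' with
    | var s' n' =>
      simp only [tW] at h
      obtain ⟨h, -⟩ := wmk h
      simp at h
      obtain ⟨rfl, rfl⟩ := h
      rfl
    | app f args => simp only [tW] at h; have h := (wmk h).1; simp at h
  | app f args ih =>
    intro s' t' h
    cases t' with
    | var s' n' => simp only [tW] at h; have h := (wmk h).1; simp at h
    | app f' args' =>
      simp only [tW] at h
      obtain ⟨h0, h⟩ := wmk h
      simp at h0
      subst h0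
      have : args = args' := by
        funext i
        have := ih i (args' i) (congrFun (eq_of_heq h) i)
        simpa using this
      rw [this]

theorem countable_W {α : Type} {β : α → Type} [∀ a, Finite (β a)] [Countable α] :
    Countable (WType β) := by
  rw [← Cardinal.mk_le_aleph0_iff]
  refine WType.cardinalMk_le_max_aleph0_of_finite'.trans ?_
  simp

theorem countable_term (hc : Sg.IsCountable) : Countable (Σ s, Term Sg s) := by
  obtain ⟨h1, h2, h3⟩ := hc
  have : ∀ a : (Sg.Sorts × ℕ) ⊕ Sg.Func, Finite (Sum.elim (fun _ => Empty)
    (fun f => Fin (Sg.funcDom f).length) a) := by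
    rintro (a | a)
    · exact inferInstanceAs (Finite Empty)
    · exact inferInstanceAs (Finite (Fin _))
  have := countable_W (β := Sum.elim (fun _ : Sg.Sorts × ℕ => Empty)
    (fun f => Fin (Sg.funcDom f).length))
  refine Function.Injective.countable (f := fun t : Σ s, Term Sg s => tW t.2) ?_
  rintro ⟨s, t⟩ ⟨s', t'⟩ h
  exact tW_inj t t' h

/-- Labels for formulas. -/
abbrev FL (Sg : MSSignature) : Type :=
  ((Σ s, Term Sg s) × (Σ s, Term Sg s)) ⊕
    ((Σ P : Sg.Pred, (Fin (Sg.predDom P).length → Σ s, Term Sg s)) ⊕ (Unit ⊕ (Unit ⊕ (Sg.Sorts × ℕ))))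

def FB : FL Sg → Type
  | .inl _ => Empty
  | .inr (.inl _) => Empty
  | .inr (.inr (.inl _)) => Empty
  | .inr (.inr (.inr (.inl _))) => Bool
  | .inr (.inr (.inr (.inr _))) => Unit

def fW : Formula Sg → WType (FB (Sg := Sg))
  | .eq (s := s) t u => ⟨.inl (⟨s, t⟩, ⟨s, u⟩), Empty.elim⟩
  | .pred P args => ⟨.inr (.inl ⟨P, fun i => ⟨_, args i⟩⟩), Empty.elim⟩
  | .falsum => ⟨.inr (.inr (.inl ())), Empty.elim⟩
  | .imp φ ψ => ⟨.inr (.inr (.inr (.inl ()))), fun b : Bool => if b then fW φ else fW ψ⟩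
  | .all s n φ => ⟨.inr (.inr (.inr (.inr (s, n)))), fun _ => fW φ⟩

theorem fW_inj (φ : Formula Sg) : ∀ ψ : Formula Sg, fW φ = fW ψ → φ = ψ := by
  induction φ with
  | eq t u =>
    intro ψ h
    cases ψ <;> simp only [fW] at h <;> obtain ⟨h0, h⟩ := wmk h <;> simp at h0
    obtain ⟨⟨rfl, h1⟩, h2⟩ := h0
    have h1 := eq_of_heq h1
    simp at h2
    rw [h1, h2]
  | pred P args =>
    intro ψ h
    cases ψ <;> simp only [fW] at h <;> obtain ⟨h0, h⟩ := wmk h <;> simp at h0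
    obtain ⟨rfl, h1⟩ := h0
    have h1 := eq_of_heq h1
    congr 1
    funext i
    have := congrFun h1 i
    simpa using this
  | falsum =>
    intro ψ h
    cases ψ <;> first | rfl | (simp only [fW] at h; obtain ⟨h0, h⟩ := wmk h; simp at h0)
  | imp φ ψ ih ih' =>
    intro χ h
    cases χ <;> simp only [fW] at h <;> obtain ⟨h0, h⟩ := wmk h <;> simp at h0
    have h1 := congrFun (eq_of_heq h) true
    have h2 := congrFun (eq_of_heq h) false
    rw [ih _ h1, ih' _ h2]
  | all s n φ ih =>
    intro χ h
    cases χ <;> simp only [fW] at h <;> obtain ⟨h0, h⟩ := wmk h <;> simp at h0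
    obtain ⟨rfl, rfl⟩ := h0
    have h1 := congrFun (eq_of_heq h) ()
    rw [ih _ h1]

theorem countable_formula (hc : Sg.IsCountable) : Countable (Formula Sg) := by
  have := countable_term hc
  obtain ⟨h1, h2, h3⟩ := hc
  have : ∀ a : FL Sg, Finite (FB a) := by
    rintro (a | a | a | a | a)
    · exact inferInstanceAs (Finite Empty)
    · exact inferInstanceAs (Finite Empty)
    · exact inferInstanceAs (Finite Empty)
    · exact inferInstanceAs (Finite Bool)
    · exact inferInstanceAs (Finite Unit)
  have : Countable (WType (FB (Sg := Sg))) := countable_W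
  exact Function.Injective.countable (f := fW) fW_inj

/-- Labels for Skolem terms. -/
abbrev SL (X : Sg.Sorts → Type) : Type :=
  (Σ s, X s) ⊕ ((Sg.Sorts × (ℕ ⊕ ℕ)) ⊕ (Sg.Func ⊕ (Formula Sg × Sg.Sorts × ℕ)))

def SB {X : Sg.Sorts → Type} : SL X → Type
  | .inl _ => Empty
  | .inr (.inl _) => Empty
  | .inr (.inr (.inl f)) => Fin (Sg.funcDom f).length
  | .inr (.inr (.inr q)) => {p // p ∈ Lv q.1}

def sW : ∀ {s : Sg.Sorts}, STm X s → WType (SB (X := X))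
  | _, .gen s x => ⟨.inl ⟨s, x⟩, Empty.elim⟩
  | _, .cst s k => ⟨.inr (.inl (s, k)), Empty.elim⟩
  | _, .app f args => ⟨.inr (.inr (.inl f)), fun i => sW (args i)⟩
  | _, .sk ψ s n args => ⟨.inr (.inr (.inr (ψ, s, n))), fun p => sW (args p)⟩

theorem sW_inj {s : Sg.Sorts} (t : STm X s) : ∀ {s' : Sg.Sorts} (t' : STm X s'),
    sW t = sW t' → (⟨s, t⟩ : Σ s, STm X s) = ⟨s', t'⟩ := by
  induction t with
  | gen s x =>
    intro s' t' h
    cases t' <;> simp only [sW] at h <;> obtain ⟨h0, h⟩ := wmk h <;> simp at h0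
    obtain ⟨rfl, h⟩ := h0
    rw [eq_of_heq h]
  | cst s k =>
    intro s' t' h
    cases t' <;> simp only [sW] at h <;> obtain ⟨h0, h⟩ := wmk h <;> simp at h0
    obtain ⟨rfl, rfl⟩ := h0
    rfl
  | app f args ih =>
    intro s' t' h
    cases t' <;> simp only [sW] at h <;> obtain ⟨h0, h⟩ := wmk h <;> simp at h0
    rename_i f' args' _
    subst h0
    have : args = args' := by
      funext i
      have := ih i (args' i) (congrFun (eq_of_heq h) i)
      simpa using this
    rw [this]
  | sk ψ s n args ih =>
    intro s' t' h
    cases t' <;> simp only [sW] at h <;> obtain ⟨h0, h⟩ := wmk h <;> simp at h0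
    rename_i ψ' n' args' _
    obtain ⟨rfl, rfl, rfl⟩ := h0
    have : args = args' := by
      funext i
      have := ih i (args' i) (congrFun (eq_of_heq h) i)
      simpa using this
    rw [this]

theorem card_STm (hc : Sg.IsCountable) (X : Sg.Sorts → Type) (lam : Cardinal) (hl : ℵ₀ ≤ lam)
    (hX : ∀ s, #(X s) ≤ lam) (s : Sg.Sorts) : #(STm X s) ≤ lam := by
  have := countable_formula hc
  obtain ⟨h1, h2, h3⟩ := hc
  have : ∀ a : SL X, Finite (SB a) := by
    rintro (a | a | a | a)
    · exact inferInstanceAs (Finite Empty)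
    · exact inferInstanceAs (Finite Empty)
    · exact inferInstanceAs (Finite (Fin _))
    · exact inferInstanceAs (Finite {p // p ∈ Lv a.1})
  have hinj : Function.Injective (fun t : STm X s => sW t) := by
    intro t t' h
    simpa using sW_inj t t' h
  refine (Cardinal.mk_le_of_injective hinj).trans ?_
  refine WType.cardinalMk_le_max_aleph0_of_finite'.trans (max_le ?_ hl)
  rw [Cardinal.lift_id, SL, Cardinal.mk_sum, Cardinal.lift_id, Cardinal.lift_id]
  refine Cardinal.add_le_of_le hl ?_ ((Cardinal.mk_le_aleph0).trans hl)
  rw [Cardinal.mk_sigma]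
  refine (Cardinal.sum_le_mk_mul_iSup _).trans ?_
  refine (mul_le_mul' (Cardinal.mk_le_aleph0.trans hl) (ciSup_le' hX)).trans ?_
  rw [Cardinal.mul_eq_self hl]

/-! The hull -/

variable {J : Type} (F : Ultrafilter J) (M : J → Structure Sg)
  (pt : ∀ j s, ℕ ⊕ ℕ → (M j).dom s) (c : J → ∀ s, X s → ℕ)

def hset (s : Sg.Sorts) : Setoid (STm X s) where
  r t t' := ∀ᶠ j in (F : Filter J), t.eval (M j) (pt j) (c j) = t'.eval (M j) (pt j) (c j)
  iseqv :=
    { refl := fun _ => Eventually.of_forall fun _ => rfl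
      symm := fun h => h.mono fun _ h => h.symm
      trans := fun h h' => (h.and h').mono fun _ h => h.1.trans h.2 }

noncomputable def Hull : Structure Sg where
  dom s := Quotient (hset F M pt c s)
  dom_nonempty s := ⟨Quotient.mk _ (.cst s (Sum.inl 0))⟩
  interpFunc f a := Quotient.mk _ (.app f fun i => (a i).out)
  interpPred P a := ∀ᶠ j in (F : Filter J),
    (M j).interpPred P fun i => ((a i).out).eval (M j) (pt j) (c j)

def hmk {s : Sg.Sorts} (t : STm X s) : (Hull F M pt c).dom s := Quotient.mk (hset F M pt c s) t

noncomputable def hout {s : Sg.Sorts} (a : (Hull F M pt c).dom s) : STm X s :=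
  Quotient.out (s := hset F M pt c s) a

theorem hmk_hout {s : Sg.Sorts} (a : (Hull F M pt c).dom s) :
    hmk F M pt c (hout F M pt c a) = a := Quotient.out_eq (s := hset F M pt c s) a

theorem hmk_eq {s : Sg.Sorts} (t t' : STm X s) : hmk F M pt c t = hmk F M pt c t' ↔
    ∀ᶠ j in (F : Filter J), t.eval (M j) (pt j) (c j) = t'.eval (M j) (pt j) (c j) :=
  Quotient.eq (r := hset F M pt c s)

theorem hout_hmk {s : Sg.Sorts} (t : STm X s) : ∀ᶠ j in (F : Filter J),
    (hout F M pt c (hmk F M pt c t)).eval (M j) (pt j) (c j) = t.eval (M j) (pt j) (c j) :=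
  (hmk_eq F M pt c _ _).1 (hmk_hout F M pt c _)

def mkA (ν : ∀ s : Sg.Sorts, ℕ → STm X s) : Assign (Hull F M pt c) :=
  fun s n => hmk F M pt c (ν s n)

noncomputable def evA (ν : ∀ s : Sg.Sorts, ℕ → STm X s) (j : J) : Assign (M j) :=
  fun s n => (ν s n).eval (M j) (pt j) (c j)

theorem los_term (ν : ∀ s : Sg.Sorts, ℕ → STm X s) {s : Sg.Sorts} (t : Term Sg s) :
    ∀ᶠ j in (F : Filter J),
      (hout F M pt c (t.eval (mkA F M pt c ν))).eval (M j) (pt j) (c j) =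
        t.eval (evA M pt c ν j) := by
  induction t with
  | var s n => exact hout_hmk F M pt c (ν s n)
  | app f args ih =>
    have h1 := hout_hmk F M pt c (.app f fun i => hout F M pt c ((args i).eval (mkA F M pt c ν)))
    have h2 := eventually_all.2 ih
    filter_upwards [h1, h2] with j h1 h2
    refine Eq.trans h1 ?_
    simp only [STm.eval, Term.eval, h2]

open Classical in
noncomputable def upd (ν : ∀ s : Sg.Sorts, ℕ → STm X s) (s : Sg.Sorts) (n : ℕ) (a : STm X s) :
    ∀ s : Sg.Sorts, ℕ → STm X s := fun t m =>
  if h : s = t then (if m = n then h ▸ a else ν t m) else ν t m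

theorem mkA_upd (ν : ∀ s : Sg.Sorts, ℕ → STm X s) (s : Sg.Sorts) (n : ℕ) (a : STm X s) :
    mkA F M pt c (upd ν s n a) = (mkA F M pt c ν).update s n (hmk F M pt c a) := by
  funext t m
  by_cases h : s = t
  · subst h
    by_cases h' : m = n <;> simp [mkA, upd, Assign.update, h']
  · simp [mkA, upd, Assign.update, h]

theorem evA_upd (ν : ∀ s : Sg.Sorts, ℕ → STm X s) (s : Sg.Sorts) (n : ℕ) (a : STm X s) (j : J) :
    evA M pt c (upd ν s n a) j = (evA M pt c ν j).update s n (a.eval (M j) (pt j) (c j)) := by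
  funext t m
  by_cases h : s = t
  · subst h
    by_cases h' : m = n <;> simp [evA, upd, Assign.update, h']
  · simp [evA, upd, Assign.update, h]

theorem los (φ : Formula Sg) : ∀ (ν : ∀ s : Sg.Sorts, ℕ → STm X s),
    Sat (Hull F M pt c) (mkA F M pt c ν) φ ↔
      ∀ᶠ j in (F : Filter J), Sat (M j) (evA M pt c ν j) φ := by
  induction φ with
  | eq t u =>
    intro ν
    simp only [Sat]
    rw [← hmk_hout F M pt c (t.eval _), ← hmk_hout F M pt c (u.eval _), hmk_eq]
    refine eventually_congr ?_
    filter_upwards [los_term F M pt c ν t, los_term F M pt c ν u] with j h1 h2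
    rw [h1, h2]
  | pred P args =>
    intro ν
    simp only [Sat]
    have h2 := eventually_all.2 fun i => los_term F M pt c ν (args i)
    refine eventually_congr ?_
    filter_upwards [h2] with j h2
    simp only [← h2]
    exact Iff.rfl
  | falsum =>
    intro ν
    simp [Sat, F.neBot.ne]
  | imp φ ψ ih ih' =>
    intro ν
    simp only [Sat]
    rw [ih, ih', Ultrafilter.eventually_imp]
  | all s n φ ih =>
    intro ν
    simp only [Sat]
    constructor
    · intro h
      by_contra hn
      rw [← Ultrafilter.eventually_not] at hn
      let b : STm X s := .sk φ s n fun p => ν p.1.1 p.1.2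
      have h1 := h (hmk F M pt c b)
      rw [← mkA_upd, ih] at h1
      obtain ⟨j, h1, h2⟩ := (h1.and hn).exists
      push Not at h2
      rw [evA_upd] at h1
      let ν' : Assign (M j) := ext (M j) (Lv φ)
        fun p => (ν p.1.1 p.1.2).eval (M j) (pt j) (c j)
      have hν : ∀ a, Sat (M j) (Assign.update (evA M pt c ν j) s n a) φ ↔
          Sat (M j) (Assign.update ν' s n a) φ := by
        intro a
        refine Lv_spec φ _ _ _ fun t m hm => ?_
        have : ν' t m = evA M pt c ν j t m := by
          simp only [ν', ext]
          rw [dif_pos hm]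
          rfl
        simp only [Assign.update, this]
      have := wit_spec (M j) φ s n ν' (by simpa [hν] using h2)
      exact this ((hν _).1 h1)
    · intro h a
      rw [← hmk_hout F M pt c a, ← mkA_upd, ih]
      filter_upwards [h] with j hj
      rw [evA_upd]
      exact hj _

theorem Hull_models (T : Set (Formula Sg)) (h : ∀ j, Models (M j) T) :
    Models (Hull F M pt c) T := by
  intro φ hφ ν
  have : ν = mkA F M pt c (fun s n => hout F M pt c (ν s n)) := by
    funext s n
    exact (hmk_hout F M pt c _).symm
  rw [this, los]
  exact Eventually.of_forall fun j => h j φ hφ _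

end sk
end MSP
/-! ### Cardinalities of the hull -/

namespace MSP

open Filter

section core
variable {Sg : MSSignature}

theorem core (hc : Sg.IsCountable) (X : Sg.Sorts → Type) [∀ s, LinearOrder (X s)]
    [LinearOrder Sg.Sorts] (κ : Sg.Sorts → Cardinal.{0}) (hX : ∀ s, #(X s) = κ s)
    (hord : ∀ s s', s ≤ s' → κ s ≤ κ s')
    (he : ∀ s, ℵ₀ ≤ κ s → ∃ e : ℕ → X s, StrictMono e) (S : Set Sg.Sorts)
    (sz : (Sg.Sorts → ℕ) → Sg.Sorts → ℕ)
    (hsz : ∀ m s, ℵ₀ ≤ κ s → m s ≤ sz m s)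
    (hszB : ∀ s, ∃ B : ℕ → ℕ, ∀ m, sz m s ≤ B (m s))
    (hszf : ∀ m s, κ s < ℵ₀ → (sz m s : Cardinal) = κ s)
    (M : (Sg.Sorts → ℕ) → Structure Sg) (pt : ∀ m s, ℕ ⊕ ℕ → (M m).dom s)
    (hsurj : ∀ m, ∀ s ∈ S, ∀ a, ∃ i < sz m s, pt m s (Sum.inr i) = a)
    (hinj : ∀ m, ∀ s ∈ S, ∀ i < sz m s, ∀ i' < sz m s,
      pt m s (Sum.inr i) = pt m s (Sum.inr i') → i = i') :
    ∃ (J : Type) (F : Ultrafilter J) (m : J → Sg.Sorts → ℕ) (c : J → ∀ s, X s → ℕ),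
      ∀ s ∈ S, #((Hull F (fun j => M (m j)) (fun j => pt (m j)) c).dom s) = κ s := by
  classical
  let V : Type := Σₗ s : Sg.Sorts, WithTop (X s)
  obtain ⟨F, hF1, hF2⟩ := comb V
  let con : ∀ s, X s → V := fun s x => toLex ⟨s, (x : WithTop (X s))⟩
  let siz : Sg.Sorts → V := fun s => toLex ⟨s, ⊤⟩
  let m : (V → ℕ) → Sg.Sorts → ℕ := fun v s => v (siz s)
  let c : (V → ℕ) → ∀ s, X s → ℕ := fun v s x => v (con s x)
  have con_lt : ∀ s x y, x < y → con s x < con s y := by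
    intro s x y h
    exact Sigma.Lex.right _ _ (WithTop.coe_lt_coe.2 h)
  have con_siz : ∀ s x, con s x < siz s := by
    intro s x
    exact Sigma.Lex.right _ _ (WithTop.coe_lt_top x)
  refine ⟨V → ℕ, F, m, c, fun s hs => ?_⟩
  set N := Hull F (fun j => M (m j)) (fun j => pt (m j)) c with hN
  rcases lt_or_ge (κ s) ℵ₀ with hfin | hinf
  · -- finite case
    obtain ⟨k, hk⟩ := Cardinal.lt_aleph0.1 hfin
    have hk' : ∀ m, sz m s = k := by
      intro m
      have := hszf m s hfin
      rw [hk] at this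
      exact_mod_cast this
    let b : Fin k → N.dom s := fun i => hmk F _ _ c (.cst s (Sum.inr i))
    have hb : Function.Bijective b := by
      constructor
      · intro i i' h
        obtain ⟨j, hj⟩ := ((hmk_eq F _ _ c _ _).1 h).exists
        exact Fin.ext (hinj _ s hs i (by rw [hk']; exact i.2) i' (by rw [hk']; exact i'.2) hj)
      · intro a
        have : ∀ᶠ j in (F : Filter (V → ℕ)), ∃ i : Fin k,
            pt (m j) s (Sum.inr i) = (hout F _ _ c a).eval (M (m j)) (pt (m j)) (c j) := by
          refine Eventually.of_forall fun j => ?_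
          obtain ⟨i, hi, h⟩ := hsurj (m j) s hs ((hout F _ _ c a).eval (M (m j)) (pt (m j)) (c j))
          exact ⟨⟨i, hk' (m j) ▸ hi⟩, h⟩
        obtain ⟨i, hi⟩ := Ultrafilter.eventually_exists_iff.1 this
        refine ⟨i, ?_⟩
        rw [← hmk_hout F _ _ c a]
        exact (hmk_eq F _ _ c _ _).2 hi
    rw [hk, ← Cardinal.mk_congr (Equiv.ofBijective b hb)]
    simp
  -- infinite case
  have key : ∀ (t : STm X s) (g : ∀ s, X s → X s),
      (∀ s' x y, (⟨s', x⟩ : Σ s, X s) ∈ t.used → (⟨s', y⟩ : Σ s, X s) ∈ t.used → x < y →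
        g s' x < g s' y) → (∀ s' x, κ s' ≤ κ s → g s' x = x) →
      ∀ᶠ j in (F : Filter (V → ℕ)), t.eval (M (m j)) (pt (m j)) (c j) =
        (t.map g).eval (M (m j)) (pt (m j)) (c j) := by
    intro t g hg1 hg2
    let γ : V → V := fun z => toLex ⟨(ofLex z).1, WithTop.map (g _) (ofLex z).2⟩
    have γc : ∀ s x, γ (con s x) = con s (g s x) := fun _ _ => rfl
    have γs : ∀ s, γ (siz s) = siz s := fun _ => rfl
    let D : Set V := {z | (∃ s, z = siz s) ∨
      ∃ s x, (⟨s, x⟩ : Σ s, X s) ∈ t.used ∧ z = con s x}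
    choose code hcode1 hcode2 using fun mm => hsurj mm s hs
    obtain ⟨B, hB⟩ := hszB s
    let G : (Sg.Sorts → ℕ) → (∀ s, X s → ℕ) → ℕ := fun mm cc => code mm (t.eval (M mm) (pt mm) cc)
    let f : (V → ℕ) → ℕ := fun v => G (m v) (c v)
    have hfin : {x ∈ D | γ x ≠ x}.Finite := by
      refine (t.used_finite.image (fun q => con q.1 q.2)).subset ?_
      rintro z ⟨⟨s', rfl⟩ | ⟨s', x, hx, rfl⟩, hz⟩
      · exact absurd (γs s') hz
      · exact ⟨⟨s', x⟩, hx, rfl⟩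
    have hγ1 : ∀ z, (ofLex (γ z)).1 = (ofLex z).1 := fun _ => rfl
    have hmono : StrictMonoOn γ D := by
      intro z hz z' hz' hlt
      obtain ⟨i, a⟩ := z
      obtain ⟨i', a'⟩ := z'
      rcases Sigma.lex_iff.1 hlt with h | ⟨h, h'⟩
      · exact Sigma.Lex.left _ _ h
      · obtain rfl : i = i' := h
        have h' : a < a' := h'
        refine Sigma.Lex.right _ _ ?_
        show WithTop.map (g i) a < WithTop.map (g i) a'
        induction a using WithTop.recTopCoe with
        | top => exact absurd h' (by simp)
        | coe a =>
          induction a' using WithTop.recTopCoe with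
          | top => simp
          | coe a' =>
            have u : ∀ a : X i, (⟨i, (a : WithTop (X i))⟩ : V) ∈ D →
                (⟨i, a⟩ : Σ s, X s) ∈ t.used := by
              rintro a (⟨s', h⟩ | ⟨s', x, hx, h⟩)
              · have h : (⟨i, (a : WithTop (X i))⟩ : Σ s, WithTop (X s)) = ⟨s', ⊤⟩ := h
                obtain ⟨rfl, h⟩ := Sigma.mk.inj_iff.1 h
                simp at h
              · have h : (⟨i, (a : WithTop (X i))⟩ : Σ s, WithTop (X s)) = ⟨s', x⟩ := h
                obtain ⟨rfl, h⟩ := Sigma.mk.inj_iff.1 h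
                have h := WithTop.coe_injective (eq_of_heq h)
                rwa [h]
            simp only [WithTop.map_coe, WithTop.coe_lt_coe]
            exact hg1 i a a' (u a hz) (u a' hz') (WithTop.coe_lt_coe.1 h')
    have hid : ∀ z ∈ D, z ≤ siz s → γ z = z := by
      rintro z (⟨s', rfl⟩ | ⟨s', x, hx, rfl⟩) hle
      · exact γs s'
      · rw [γc, hg2]
        refine hord _ _ ?_
        rcases Sigma.lex_iff.1 hle with h | ⟨h, h'⟩
        · exact le_of_lt h
        · exact le_of_eq h
    have hres := hF2 (siz s) D γ f B (Or.inl ⟨s, rfl⟩) hmono hid hfin ?_ ?_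
    · filter_upwards [hres] with v hv
      have e1 : f (v ∘ γ) = G (m v) (fun s x => c v s (g s x)) := rfl
      rw [e1] at hv
      have hv : code (m v) (t.eval (M (m v)) (pt (m v)) (c v)) =
        code (m v) (t.eval (M (m v)) (pt (m v)) (fun s x => c v s (g s x))) := hv
      rw [STm.eval_map, ← hcode2 (m v) (t.eval (M (m v)) (pt (m v)) (c v)), hv, hcode2]
    · intro v v' hvv
      have e1 : m v = m v' := funext fun s' => hvv (Or.inl ⟨s', rfl⟩)
      show G (m v) (c v) = G (m v') (c v')
      rw [e1]
      show code _ _ = code _ _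
      congr 1
      refine STm.eval_congr _ _ _ _ _ fun s' x hx => ?_
      exact hvv (Or.inr ⟨s', x, hx, rfl⟩)
    · intro v
      exact (hcode1 _ _).le.trans (hB (m v))
  apply le_antisymm
  · choose e he using he
    let Y : Sg.Sorts → Type := fun s' =>
      {x : X s' // κ s' ≤ κ s ∨ ∃ h : ℵ₀ ≤ κ s', x ∈ Set.range (e s' h)}
    have hY : ∀ s', #(Y s') ≤ κ s := by
      intro s'
      by_cases h : κ s' ≤ κ s
      · exact (Cardinal.mk_subtype_le _).trans ((hX s').le.trans h)
      · have h' : ℵ₀ ≤ κ s' := hinf.trans (not_le.1 h).le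
        have : #(Y s') ≤ #(Set.range (e s' h')) :=
          Cardinal.mk_le_mk_of_subset (s := {x : X s' | κ s' ≤ κ s ∨
            ∃ h : ℵ₀ ≤ κ s', x ∈ Set.range (e s' h)}) (by
              rintro x (hx | ⟨_, hx⟩)
              · exact absurd hx h
              · exact hx)
        exact (this.trans (Cardinal.mk_le_aleph0_iff.2 (Set.countable_range _).to_subtype)).trans hinf
    have hcardY := card_STm hc Y (κ s) hinf hY s
    refine le_trans ?_ hcardY
    refine Cardinal.mk_le_of_surjective
      (f := fun u : STm Y s => (hmk F _ _ c (u.map fun _ y => y.1) : N.dom s)) ?_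
    intro a
    set t := hout F _ _ c a with ht
    let rk : ∀ s', X s' → ℕ := fun s' x =>
      Set.ncard {q : Σ s, X s | q ∈ t.used ∧ ∃ y, q = ⟨s', y⟩ ∧ y < x}
    let g : ∀ s', X s' → Y s' := fun s' x =>
      if h : κ s' ≤ κ s then ⟨x, Or.inl h⟩
      else ⟨e s' (hinf.trans (not_le.1 h).le) (rk s' x), Or.inr ⟨_, Set.mem_range_self _⟩⟩
    refine ⟨t.map g, ?_⟩
    show hmk F _ _ c ((t.map g).map fun _ y => y.1) = a
    rw [STm.map_map]
    refine Eq.trans ?_ (hmk_hout F _ _ c a)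
    rw [← ht]
    refine ((hmk_eq F _ _ c _ _).2 (key t _ ?_ ?_)).symm
    · intro s' x y hx hy hxy
      by_cases h : κ s' ≤ κ s
      · simpa [g, h] using hxy
      · simp only [g, h, dif_neg, not_false_eq_true]
        refine he _ _ ?_
        refine Set.ncard_lt_ncard ?_ (t.used_finite.subset fun q hq => hq.1)
        rw [Set.ssubset_iff_of_subset]
        · refine ⟨⟨s', x⟩, ⟨hx, x, rfl, hxy⟩, ?_⟩
          rintro ⟨-, z, hz, hz'⟩
          obtain rfl : x = z := by simpa using hz
          exact lt_irrefl _ hz'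
        · rintro q ⟨hq, z, rfl, hz⟩
          exact ⟨hq, z, rfl, hz.trans hxy⟩
    · intro s' x h
      simp [g, h]
  · rw [← hX s]
    refine Cardinal.mk_le_of_injective (f := fun x : X s => (hmk F _ _ c (.gen s x) : N.dom s)) ?_
    have aux : ∀ x y : X s, x < y → (hmk F _ _ c (.gen s x) : N.dom s) ≠ hmk F _ _ c (.gen s y) := by
      intro x y hxy h
      have h := (hmk_eq F _ _ c _ _).1 h
      obtain ⟨v, h1, h2, h3⟩ := (h.and ((hF1 _ _ (con_lt s x y hxy)).and
        (hF1 _ _ (con_siz s y)))).exists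
      have h3' : c v s y < sz (m v) s := lt_of_lt_of_le h3 (hsz (m v) s hinf)
      exact h2.ne (hinj (m v) s hs _ (lt_trans h2 h3') _ h3' h1)
    intro x y h
    rcases lt_trichotomy x y with h' | h' | h'
    · exact absurd h (aux x y h')
    · exact h'
    · exact absurd h.symm (aux y x h')

end core
end MSP

/-- Over a countable many-sorted signature, a theory that is stably finite and
finitely smooth with respect to a set of sorts `S` is smooth with respect to `S`. -/
theorem smooth_of_stablyFinite_finitelySmooth {Sg : MSSignature}
    (hc : Sg.IsCountable) (T : Set (MS.Formula Sg)) (S : Set Sg.Sorts)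
    (hsf : StablyFinite T S) (hfs : FinitelySmooth T S) :
    Smooth T S := by
  classical
  intro φ hφ A ν hA hsat κ hκ
  obtain ⟨B, μ, hB, hBs, hBf⟩ := hsf φ hφ A ν hA hsat
  let b : Sg.Sorts → ℕ := fun s => Nat.card (B.dom s)
  let sz : (Sg.Sorts → ℕ) → Sg.Sorts → ℕ := fun m s =>
    if κ s < ℵ₀ then Cardinal.toNat (κ s) else max (b s) (m s)
  have hb : ∀ s ∈ S, #(B.dom s) = b s := by
    intro s hs
    have := (hBf s hs).2
    exact (Nat.cast_card).symm
  have hszf : ∀ m s, κ s < ℵ₀ → (sz m s : Cardinal) = κ s := by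
    intro m s h
    simp only [sz, if_pos h]
    exact Cardinal.cast_toNat_of_lt_aleph0 h
  have hmod : ∀ m : Sg.Sorts → ℕ, ∃ (C : Structure Sg) (μ : Assign C), Models C T ∧ Sat C μ φ ∧
      ∀ s ∈ S, #(C.dom s) = sz m s := by
    intro m
    obtain ⟨C, μ', h1, h2, h3⟩ := hfs φ hφ B μ hB hBs (fun s => (sz m s : Cardinal)) (by
      intro s hs _
      refine ⟨?_, Cardinal.natCast_lt_aleph0⟩
      by_cases h : κ s < ℵ₀
      · rw [hszf m s h]
        exact (hBf s hs).1.trans (hκ s hs)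
      · rw [hb s hs]
        simp only [sz, if_neg h]
        exact_mod_cast le_max_left _ _)
    exact ⟨C, μ', h1, h2, fun s hs => h3 s hs (hBf s hs).2⟩
  choose M μ' hM hMs hMc using hmod
  have hel : ∀ m s, ∃ e : ℕ → (M m).dom s, s ∈ S → (∀ a, ∃ i < sz m s, e i = a) ∧
      ∀ i < sz m s, ∀ i' < sz m s, e i = e i' → i = i' := by
    intro m s
    by_cases hs : s ∈ S
    · have h := hMc m s hs
      have h' : #((M m).dom s) = #(Fin (sz m s)) := by rw [h]; simp
      obtain ⟨E⟩ := Cardinal.eq.1 h'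
      obtain ⟨d⟩ := (M m).dom_nonempty s
      refine ⟨fun i => if h : i < sz m s then E.symm ⟨i, h⟩ else d, fun _ => ⟨?_, ?_⟩⟩
      · intro a
        exact ⟨E a, (E a).2, by simp⟩
      · intro i hi i' hi' h
        simp only [dif_pos hi, dif_pos hi'] at h
        simpa using h
    · obtain ⟨d⟩ := (M m).dom_nonempty s
      exact ⟨fun _ => d, fun h => absurd h hs⟩
  choose el hel using hel
  have hcS : Countable Sg.Sorts := hc.1
  obtain ⟨enc, henc⟩ := exists_injective_nat Sg.Sorts
  let ι : Sg.Sorts → Cardinal.{0} ×ₗ ℕ := fun s => toLex (κ s, enc s)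
  have hι : Function.Injective ι := by
    intro s s' h
    have h : (κ s, enc s) = (κ s', enc s') := h
    exact henc (Prod.mk.inj h).2
  letI : LinearOrder Sg.Sorts := LinearOrder.lift' ι hι
  obtain ⟨J, F, m, c, hcard⟩ := MSP.core hc (fun s => (κ s).ord.ToType) κ
    (fun s => Cardinal.mk_ord_toType _) (by
      intro s s' h
      have h : ι s ≤ ι s' := h
      rcases (Prod.Lex.le_iff.1 h) with h | h
      · exact le_of_lt h
      · exact le_of_eq h.1)
    (by
      intro s h
      have := Cardinal.noMaxOrder h
      have : Nonempty (κ s).ord.ToType := by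
        rw [← Cardinal.mk_ne_zero_iff, Cardinal.mk_ord_toType]
        exact (lt_of_lt_of_le Cardinal.aleph0_pos h).ne'
      exact Nat.exists_strictMono _)
    S sz (by
      intro m s h
      simp only [sz, if_neg (not_lt.2 h)]
      exact le_max_right _ _)
    (by
      intro s
      by_cases h : κ s < ℵ₀
      · exact ⟨fun _ => Cardinal.toNat (κ s), fun m => by simp only [sz, if_pos h]; exact le_rfl⟩
      · exact ⟨fun k => max (b s) k, fun m => by simp only [sz, if_neg h]; exact le_rfl⟩)
    hszf M (fun m s => Sum.elim (μ' m s) (el m s))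
    (fun m s hs a => (hel m s hs).1 a) (fun m s hs => (hel m s hs).2)
  refine ⟨_, MSP.mkA F (fun j => M (m j)) (fun j s => Sum.elim (μ' (m j) s) (el (m j) s)) c
    (fun s n => .cst s (Sum.inl n)), MSP.Hull_models F _ _ c T fun j => hM (m j), ?_, hcard⟩
  rw [MSP.los]
  exact Filter.Eventually.of_forall fun j => hMs (m j)
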